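/- Let σ be a single-qubit state with Bloch vector x_σ, 0 < r_σ = |x_σ| < 1, and φ as above with Tr(φσ) = 0. Then the state ρ(σ,φ,t) = σ − t·(φ ⊙ L(σ)) (Hadamard product in the eigenbasis of σ) has Bloch vector x_ρ = x_σ − (t/(2r_σ²))[ (r_σ² − 1)φ₀ x_σ + 2 g_{r_σ}(φ₀ x_σ + r_σ² x_φ) ], where g_r = r/ln((1+r)/(1−r)). -/

import Mathlib

open Matrix

def pauliX : Matrix (Fin 2) (Fin 2) ℂ := !![0, 1; 1, 0]
def pauliY : Matrix (Fin 2) (Fin 2) ℂ := !![0, -Complex.I; Complex.I, 0]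
def pauliZ : Matrix (Fin 2) (Fin 2) ℂ := !![1, 0; 0, -1]

/-- `bloch a x = ½ (a I + x₁ X + x₂ Y + x₃ Z)`. -/
noncomputable def bloch (a : ℝ) (x : Fin 3 → ℝ) : Matrix (Fin 2) (Fin 2) ℂ :=
  (1 / 2 : ℂ) • ((a : ℂ) • (1 : Matrix (Fin 2) (Fin 2) ℂ)
    + (x 0 : ℂ) • pauliX + (x 1 : ℂ) • pauliY + (x 2 : ℂ) • pauliZ)
open scoped Matrix

/-- The log-mean Hadamard multiplier, expressed via the spectral reflection. -/
lemma hadamard_two (A : Matrix (Fin 2) (Fin 2) ℂ) (e0 e1 g d : ℂ) (hd : e0 - e1 = d)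
    (hd0 : d ≠ 0) (he : e0 + e1 = 1) :
    A ⊙ !![e0, g; g, e1] =
      (g / 2) • (A - (1 / d ^ 2) • (((2 : ℂ) • !![e0, 0; 0, e1] - 1) * A *
        ((2 : ℂ) • !![e0, 0; 0, e1] - 1)))
      + (1 / 2 : ℂ) • ((A + (1 / d ^ 2) • (((2 : ℂ) • !![e0, 0; 0, e1] - 1) * A *
        ((2 : ℂ) • !![e0, 0; 0, e1] - 1))) * !![e0, 0; 0, e1]) := by
  have h : (2 : ℂ) • !![e0, 0; 0, e1] - 1 = !![d, 0; 0, -d] := by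
    ext i j
    fin_cases i <;> fin_cases j <;> simp
    · linear_combination hd + he
    · linear_combination he - hd
  rw [h, Matrix.eta_fin_two A]
  ext i j
  fin_cases i <;> fin_cases j <;> simp <;> field_simp <;> ring

lemma conj_formula (U V A D : Matrix (Fin 2) (Fin 2) ℂ) (c g : ℂ) (h1 : U * V = 1)
    (h2 : V * U = 1) :
    U * ((g / 2) • (V * A * U - c • (((2 : ℂ) • D - 1) * (V * A * U) * ((2 : ℂ) • D - 1)))
      + (1 / 2 : ℂ) • ((V * A * U + c • (((2 : ℂ) • D - 1) * (V * A * U) *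
        ((2 : ℂ) • D - 1))) * D)) * V =
    (g / 2) • (A - c • (((2 : ℂ) • (U * D * V) - 1) * A * ((2 : ℂ) • (U * D * V) - 1)))
      + (1 / 2 : ℂ) • ((A + c • (((2 : ℂ) • (U * D * V) - 1) * A *
        ((2 : ℂ) • (U * D * V) - 1))) * (U * D * V)) := by
  have k1 : ∀ X : Matrix (Fin 2) (Fin 2) ℂ, U * (V * X) = X := fun X => by
    rw [← Matrix.mul_assoc, h1, Matrix.one_mul]
  have k2 : ∀ X : Matrix (Fin 2) (Fin 2) ℂ, V * (U * X) = X := fun X => by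
    rw [← Matrix.mul_assoc, h2, Matrix.one_mul]
  simp only [Matrix.mul_add, Matrix.add_mul, Matrix.mul_sub, Matrix.sub_mul, Matrix.mul_smul,
    Matrix.smul_mul, Matrix.mul_assoc, k1, k2, h1, h2, Matrix.mul_one, Matrix.one_mul]

lemma bloch_eq (a : ℝ) (x : Fin 3 → ℝ) : bloch a x =
    !![((a : ℂ) + x 2) / 2, ((x 0 : ℂ) - Complex.I * x 1) / 2;
       ((x 0 : ℂ) + Complex.I * x 1) / 2, ((a : ℂ) - x 2) / 2] := by
  ext i j
  fin_cases i <;> fin_cases j <;> simp [bloch, pauliX, pauliY, pauliZ] <;> ring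

lemma logmean (e0 e1 r : ℝ) (hr0 : 0 < r) (hr1 : r < 1) (h0 : e0 = (1 + r) / 2)
    (h1 : e1 = (1 - r) / 2) :
    (e0 - e1) / (Real.log e0 - Real.log e1) = r / Real.log ((1 + r) / (1 - r)) := by
  have p0 : e0 ≠ 0 := by rw [h0]; positivity
  have p1 : e1 ≠ 0 := by rw [h1]; have : 0 < 1 - r := by linarith
                         positivity
  rw [← Real.log_div p0 p1, h0, h1]
  have : 1 - r ≠ 0 := by linarith
  congr 2
  · ring
  · field_simp

lemma logmean_symm (e0 e1 : ℝ) :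
    (e0 - e1) / (Real.log e0 - Real.log e1) = (e1 - e0) / (Real.log e1 - Real.log e0) := by
  rw [← neg_sub e1 e0, ← neg_sub (Real.log e1), neg_div_neg_eq]

lemma final_calc (p q c u v z f S G T : ℂ) (hS : S = p * q + c ^ 2) (hS0 : S ≠ 0)
    (hf : f = -((p * v + q * u) / 2 + c * z)) :
    !![(1 + c) / 2, p / 2; q / 2, (1 - c) / 2] - T •
      ((G / 2) • (!![(f + z) / 2, u / 2; v / 2, (f - z) / 2] - (1 / S) •
        (((2 : ℂ) • !![(1 + c) / 2, p / 2; q / 2, (1 - c) / 2] - 1) *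
          !![(f + z) / 2, u / 2; v / 2, (f - z) / 2] *
          ((2 : ℂ) • !![(1 + c) / 2, p / 2; q / 2, (1 - c) / 2] - 1)))
      + (1 / 2 : ℂ) • ((!![(f + z) / 2, u / 2; v / 2, (f - z) / 2] + (1 / S) •
        (((2 : ℂ) • !![(1 + c) / 2, p / 2; q / 2, (1 - c) / 2] - 1) *
          !![(f + z) / 2, u / 2; v / 2, (f - z) / 2] *
          ((2 : ℂ) • !![(1 + c) / 2, p / 2; q / 2, (1 - c) / 2] - 1))) *
          !![(1 + c) / 2, p / 2; q / 2, (1 - c) / 2])) =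
    !![(1 + (c - T / (2 * S) * ((S - 1) * f * c + 2 * G * (f * c + S * z)))) / 2,
       (p - T / (2 * S) * ((S - 1) * f * p + 2 * G * (f * p + S * u))) / 2;
       (q - T / (2 * S) * ((S - 1) * f * q + 2 * G * (f * q + S * v))) / 2,
       (1 - (c - T / (2 * S) * ((S - 1) * f * c + 2 * G * (f * c + S * z)))) / 2] := by
  have h : (2 : ℂ) • !![(1 + c) / 2, p / 2; q / 2, (1 - c) / 2] - 1 = !![c, p; q, -c] := by
    ext i j
    fin_cases i <;> fin_cases j <;> simp <;> ring
  rw [h]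
  ext i j
  fin_cases i <;> fin_cases j <;> simp <;> field_simp <;> rw [hf, hS] <;> ring

theorem bloch_vector_of_closest_family (xσ xφ : Fin 3 → ℝ) (φ0 t r : ℝ)
    (hr : r = Real.sqrt (∑ i, xσ i ^ 2)) (hr0 : 0 < r) (hr1 : r < 1)
    (hφ0 : φ0 = -∑ i, xσ i * xφ i)
    (hσ : (bloch 1 xσ).IsHermitian) :
    bloch 1 xσ - (t : ℂ) •
      ((hσ.eigenvectorUnitary : Matrix (Fin 2) (Fin 2) ℂ) *
        ((star (hσ.eigenvectorUnitary : Matrix (Fin 2) (Fin 2) ℂ) * bloch φ0 xφ *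
            (hσ.eigenvectorUnitary : Matrix (Fin 2) (Fin 2) ℂ)) ⊙
          Matrix.of fun k l =>
            if hσ.eigenvalues k = hσ.eigenvalues l then (hσ.eigenvalues k : ℂ)
            else (((hσ.eigenvalues k - hσ.eigenvalues l) /
              (Real.log (hσ.eigenvalues k) - Real.log (hσ.eigenvalues l)) : ℝ) : ℂ)) *
        star (hσ.eigenvectorUnitary : Matrix (Fin 2) (Fin 2) ℂ)) =
    bloch 1 (fun i => xσ i - t / (2 * r ^ 2) *
      ((r ^ 2 - 1) * φ0 * xσ i +
        2 * (r / Real.log ((1 + r) / (1 - r))) * (φ0 * xσ i + r ^ 2 * xφ i))) := by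
  have hr2 : r ^ 2 = xσ 0 ^ 2 + xσ 1 ^ 2 + xσ 2 ^ 2 := by
    rw [hr, Real.sq_sqrt (Finset.sum_nonneg fun i _ => sq_nonneg _), Fin.sum_univ_three]
  have htr : hσ.eigenvalues 0 + hσ.eigenvalues 1 = 1 := by
    have h := hσ.trace_eq_sum_eigenvalues
    rw [Fin.sum_univ_two] at h
    have h' : ((hσ.eigenvalues 0 + hσ.eigenvalues 1 : ℝ) : ℂ) = ((1 : ℝ) : ℂ) := by
      push_cast
      refine h.symm.trans ?_
      rw [bloch_eq, Matrix.trace_fin_two_of]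
      push_cast
      ring
    exact_mod_cast h'
  have hdet : hσ.eigenvalues 0 * hσ.eigenvalues 1 = (1 - r ^ 2) / 4 := by
    have h := hσ.det_eq_prod_eigenvalues
    rw [Fin.prod_univ_two] at h
    have h' : ((hσ.eigenvalues 0 * hσ.eigenvalues 1 : ℝ) : ℂ) = (((1 - r ^ 2) / 4 : ℝ) : ℂ) := by
      rw [hr2]
      push_cast
      refine h.symm.trans ?_
      rw [bloch_eq, Matrix.det_fin_two_of]
      push_cast
      linear_combination ((xσ 1 : ℂ) ^ 2 / 4) * Complex.I_sq
    exact_mod_cast h'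
  have hspec := hσ.spectral_theorem
  have hU1 : (hσ.eigenvectorUnitary : Matrix (Fin 2) (Fin 2) ℂ) *
      star (hσ.eigenvectorUnitary : Matrix (Fin 2) (Fin 2) ℂ) = 1 :=
    Unitary.coe_mul_star_self _
  have hU2 : star (hσ.eigenvectorUnitary : Matrix (Fin 2) (Fin 2) ℂ) *
      (hσ.eigenvectorUnitary : Matrix (Fin 2) (Fin 2) ℂ) = 1 :=
    Unitary.coe_star_mul_self _
  rw [Unitary.conjStarAlgAut_apply] at hspec
  generalize (hσ.eigenvectorUnitary : Matrix (Fin 2) (Fin 2) ℂ) = U at *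
  generalize hσ.eigenvalues = e at *
  have hd2 : (e 0 - e 1) ^ 2 = r ^ 2 := by
    linear_combination (e 0 + e 1 + 1) * htr - 4 * hdet
  have hd0 : e 0 - e 1 ≠ 0 := by
    intro h
    rw [h] at hd2
    have : 0 < r ^ 2 := by positivity
    linarith
  have hg : (e 0 - e 1) / (Real.log (e 0) - Real.log (e 1)) =
      r / Real.log ((1 + r) / (1 - r)) := by
    rcases sq_eq_sq_iff_eq_or_eq_neg.mp hd2 with h | h
    · exact logmean _ _ _ hr0 hr1 (by linarith) (by linarith)
    · rw [logmean_symm]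
      exact logmean _ _ _ hr0 hr1 (by linarith) (by linarith)
  have hg' := (logmean_symm (e 1) (e 0)).trans hg
  generalize r / Real.log ((1 + r) / (1 - r)) = g at *
  have hL : (Matrix.of fun k l => if e k = e l then (e k : ℂ)
      else (((e k - e l) / (Real.log (e k) - Real.log (e l)) : ℝ) : ℂ)) =
      !![(e 0 : ℂ), (g : ℂ); (g : ℂ), (e 1 : ℂ)] := by
    have n1 : e 0 ≠ e 1 := sub_ne_zero.mp hd0
    ext i j
    fin_cases i <;> fin_cases j
    · simp
    · simp only [Matrix.of_apply, Fin.zero_eta, Fin.mk_one, if_neg n1, hg]; simp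
    · simp only [Matrix.of_apply, Fin.zero_eta, Fin.mk_one, if_neg n1.symm, hg']; simp
    · simp
  have hD : (diagonal (RCLike.ofReal ∘ e) : Matrix (Fin 2) (Fin 2) ℂ) =
      !![(e 0 : ℂ), 0; 0, (e 1 : ℂ)] := by
    ext i j
    fin_cases i <;> fin_cases j <;> simp
  rw [hD] at hspec
  rw [hL, hadamard_two _ (e 0) (e 1) g ((e 0 - e 1 : ℝ) : ℂ) (by push_cast; ring)
    (by exact_mod_cast hd0) (by exact_mod_cast htr), conj_formula _ _ _ _ _ _ hU1 hU2, ← hspec]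
  have hdc : ((e 0 - e 1 : ℝ) : ℂ) ^ 2 = (r : ℂ) ^ 2 := by exact_mod_cast hd2
  rw [hdc]
  have hrc : (r : ℂ) ≠ 0 := by exact_mod_cast hr0.ne'
  have hr2c : (r : ℂ) ^ 2 = (xσ 0 : ℂ) ^ 2 + (xσ 1 : ℂ) ^ 2 + (xσ 2 : ℂ) ^ 2 := by
    exact_mod_cast hr2
  rw [Fin.sum_univ_three] at hφ0
  have hφc : (φ0 : ℂ) = -((xσ 0 : ℂ) * xφ 0 + xσ 1 * xφ 1 + xσ 2 * xφ 2) := by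
    exact_mod_cast hφ0
  have hI : Complex.I ^ 2 = -1 := Complex.I_sq
  simp only [bloch_eq]
  push_cast
  generalize (xσ 0 : ℂ) = a at *
  generalize (xσ 1 : ℂ) = b at *
  generalize (xσ 2 : ℂ) = c at *
  generalize (xφ 0 : ℂ) = x at *
  generalize (xφ 1 : ℂ) = y at *
  generalize (xφ 2 : ℂ) = z at *
  generalize (φ0 : ℂ) = f at *
  generalize (r : ℂ) = R at *
  have hR : R ^ 2 ≠ 0 := pow_ne_zero 2 hrc
  generalize R ^ 2 = S at *
  generalize (g : ℂ) = G at *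
  generalize (t : ℂ) = T at *
  generalize Complex.I = J at *
  rw [final_calc (a - J * b) (a + J * b) c (x - J * y) (x + J * y) z f S G T
    (by rw [hr2c]; linear_combination b ^ 2 * hI) hR
    (by rw [hφc]; linear_combination (-b * y) * hI)]
  ext i j
  fin_cases i <;> fin_cases j <;> simp <;> ring
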